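/- arXiv:2308.10711 — 5 statements merged into one kernel-verified Lean document; each statement's English description precedes it below -/
import Mathlib

section
/- Let p ≥ 1, let Θ ⊆ [0,1]^p be convex and compact with Θ_bin := Θ ∩ {0,1}^p nonempty and Θ \ Θ_bin nonempty, let Λ ⊆ ℝ^m be nonempty and compact, and let G : ℝ^m × ℝ^p → ℝ be continuous on Λ × Θ and such that for every λ ∈ Λ the map θ ↦ G(λ,θ) is L-Lipschitz on Θ (Euclidean norm) for a constant L > 0. Then there exists ε̄ > 0 such that for every ε ∈ (0, ε̄], the set of global minimizers of G over Λ × Θ_bin coincides with the set of global minimizers of (λ,θ) ↦ G(λ,θ) + (1/ε)·φ(θ) over Λ × Θ, where φ(θ) = Σ_{i=1}^p θ_i(1−θ_i). -/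
open scoped BigOperators

/-- The concave penalty function `φ(θ) = ∑ i, θ i (1 - θ i)`. -/
noncomputable def phi {p : ℕ} (θ : EuclideanSpace ℝ (Fin p)) : ℝ :=
  ∑ i, θ i * (1 - θ i)

theorem EuclideanSpace.norm_le_sum_abs {ι : Type*} [Fintype ι] (x : EuclideanSpace ℝ ι) :
    ‖x‖ ≤ ∑ i, |x i| := by
  rw [EuclideanSpace.norm_eq]
  refine Real.sqrt_le_iff.2 ⟨Finset.sum_nonneg fun i _ => abs_nonneg _, ?_⟩
  simpa using Finset.sum_sq_le_sq_sum_of_nonneg (s := Finset.univ) (f := fun i => |x i|)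
    fun i _ => abs_nonneg _

theorem continuous_phi {p : ℕ} : Continuous (phi (p := p)) := by
  unfold phi
  fun_prop

theorem phi_nonneg {p : ℕ} {θ : EuclideanSpace ℝ (Fin p)}
    (hθ : ∀ i, θ i ∈ Set.Icc (0 : ℝ) 1) : 0 ≤ phi θ :=
  Finset.sum_nonneg fun i _ => mul_nonneg (hθ i).1 (sub_nonneg.2 (hθ i).2)

theorem phi_eq_zero_iff {p : ℕ} {θ : EuclideanSpace ℝ (Fin p)}
    (hθ : ∀ i, θ i ∈ Set.Icc (0 : ℝ) 1) : phi θ = 0 ↔ ∀ i, θ i = 0 ∨ θ i = 1 := by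
  unfold phi
  rw [Finset.sum_eq_zero_iff_of_nonneg
    fun i _ => mul_nonneg (hθ i).1 (sub_nonneg.2 (hθ i).2)]
  simp [sub_eq_zero, eq_comm (a := (1 : ℝ))]

/-- Near a vertex of the unit cube, the penalty dominates half the distance to that vertex. -/
theorem half_dist_le_phi {p : ℕ} {θ z : EuclideanSpace ℝ (Fin p)}
    (hθ : ∀ i, θ i ∈ Set.Icc (0 : ℝ) 1) (hz : ∀ i, z i = 0 ∨ z i = 1)
    (hd : dist θ z ≤ 1 / 2) : 1 / 2 * dist θ z ≤ phi θ := by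
  rw [dist_eq_norm] at hd ⊢
  have hsum : 1 / 2 * ‖θ - z‖ ≤ 1 / 2 * ∑ i, |(θ - z) i| := by
    gcongr
    exact EuclideanSpace.norm_le_sum_abs _
  refine hsum.trans ?_
  rw [Finset.mul_sum]
  refine Finset.sum_le_sum fun i _ => ?_
  have hi : |θ i - z i| ≤ 1 / 2 := by
    simpa using (PiLp.norm_apply_le (θ - z) i).trans hd
  obtain ⟨h0, h1⟩ := hθ i
  rw [PiLp.sub_apply]
  rcases hz i with h | h <;> rw [h] at hi ⊢
  · rw [sub_zero, abs_of_nonneg h0] at *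
    nlinarith
  · rw [abs_of_nonpos (by linarith)] at *
    nlinarith

/-- A linear error bound: on a compact subset `Θ` of the unit cube, the penalty dominates a
multiple of the distance to the binary points of `Θ`. -/
theorem exists_dist_le_phi {p : ℕ} {Θ : Set (EuclideanSpace ℝ (Fin p))}
    (hsub : Θ ⊆ {θ | ∀ i, θ i ∈ Set.Icc (0 : ℝ) 1}) (hΘ : IsCompact Θ)
    (hne : (Θ ∩ {θ | ∀ i, θ i = 0 ∨ θ i = 1}).Nonempty) :
    ∃ c > (0 : ℝ), ∀ θ ∈ Θ, ∃ z ∈ Θ ∩ {θ | ∀ i, θ i = 0 ∨ θ i = 1},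
      c * dist θ z ≤ phi θ := by
  set B := Θ ∩ {θ | ∀ i, θ i = 0 ∨ θ i = 1} with hB
  obtain ⟨z₀, hz₀⟩ := hne
  set K := Θ \ ⋃ z ∈ B, Metric.ball z (1 / 2)
  have hK : IsCompact K := hΘ.diff (isOpen_biUnion fun z _ => Metric.isOpen_ball)
  have hpos : ∀ θ ∈ K, 0 < phi θ := by
    intro θ hθ
    refine (phi_nonneg (hsub hθ.1)).lt_of_ne' fun h => hθ.2 ?_
    exact Set.mem_biUnion (show θ ∈ B from ⟨hθ.1, (phi_eq_zero_iff (hsub hθ.1)).1 h⟩)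
      (Metric.mem_ball_self (by norm_num))
  obtain ⟨δ, hδ, hδK⟩ := hK.exists_forall_le' continuous_phi.continuousOn hpos
  obtain ⟨D, hD⟩ := Metric.isBounded_iff.1 hΘ.isBounded
  have hD0 : 0 ≤ D := dist_nonneg.trans (hD hz₀.1 hz₀.1)
  refine ⟨min (1 / 2) (δ / (D + 1)), by positivity, fun θ hθ => ?_⟩
  by_cases hθK : θ ∈ K
  · refine ⟨z₀, hz₀, ?_⟩
    calc min (1 / 2) (δ / (D + 1)) * dist θ z₀ ≤ δ / (D + 1) * (D + 1) := by
          gcongr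
          · exact min_le_right _ _
          · linarith [hD hθ hz₀.1]
      _ = δ := by field_simp
      _ ≤ phi θ := hδK θ hθK
  · obtain ⟨z, hz, hzd⟩ : ∃ z ∈ B, dist θ z < 1 / 2 := by
      by_contra! h
      exact hθK ⟨hθ, by simpa using h⟩
    refine ⟨z, hz, le_trans ?_ (half_dist_le_phi (hsub hθ) hz.2 hzd.le)⟩
    gcongr
    exact min_le_left _ _

/-- Theorem: for `ε` small enough, the global minimizers of `G` over `Λ × Θ_bin`
coincide with the global minimizers of `G + (1/ε) φ` over `Λ × Θ`. -/
theorem penalty_equivalence {m p : ℕ} (hp : 1 ≤ p)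
    (Θ : Set (EuclideanSpace ℝ (Fin p)))
    (hΘsub : Θ ⊆ {θ | ∀ i, θ i ∈ Set.Icc (0 : ℝ) 1})
    (hΘconv : Convex ℝ Θ) (hΘcomp : IsCompact Θ)
    (Θbin : Set (EuclideanSpace ℝ (Fin p)))
    (hΘbin : Θbin = Θ ∩ {θ | ∀ i, θ i = 0 ∨ θ i = 1})
    (hΘbinne : Θbin.Nonempty) (hdiff : (Θ \ Θbin).Nonempty)
    (Λ : Set (EuclideanSpace ℝ (Fin m))) (hΛne : Λ.Nonempty) (hΛcomp : IsCompact Λ)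
    (G : EuclideanSpace ℝ (Fin m) → EuclideanSpace ℝ (Fin p) → ℝ)
    (hGcont : ContinuousOn
      (fun x : EuclideanSpace ℝ (Fin m) × EuclideanSpace ℝ (Fin p) => G x.1 x.2) (Λ ×ˢ Θ))
    (L : ℝ) (hL : 0 < L)
    (hLip : ∀ lam ∈ Λ, LipschitzOnWith L.toNNReal (G lam) Θ) :
    ∃ εbar > (0 : ℝ), ∀ ε : ℝ, 0 < ε → ε ≤ εbar →
      {x : EuclideanSpace ℝ (Fin m) × EuclideanSpace ℝ (Fin p) |
        x ∈ Λ ×ˢ Θbin ∧ ∀ y ∈ Λ ×ˢ Θbin, G x.1 x.2 ≤ G y.1 y.2}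
      = {x : EuclideanSpace ℝ (Fin m) × EuclideanSpace ℝ (Fin p) |
        x ∈ Λ ×ˢ Θ ∧ ∀ y ∈ Λ ×ˢ Θ,
          G x.1 x.2 + (1 / ε) * phi x.2 ≤ G y.1 y.2 + (1 / ε) * phi y.2} := by
  subst hΘbin
  obtain ⟨c, hc, hbound⟩ := exists_dist_le_phi hΘsub hΘcomp hΘbinne
  refine ⟨c / (2 * L), by positivity, fun ε hε hεle => ?_⟩
  have hzero : ∀ z ∈ Θ ∩ {θ | ∀ i, θ i = 0 ∨ θ i = 1}, phi z = 0 := fun z hz =>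
    (phi_eq_zero_iff (hΘsub hz.1)).2 hz.2
  have hproj : ∀ lam ∈ Λ, ∀ θ ∈ Θ, ∃ z ∈ Θ ∩ {θ | ∀ i, θ i = 0 ∨ θ i = 1},
      G lam z + L * dist θ z ≤ G lam θ + (1 / ε) * phi θ := by
    intro lam hlam θ hθ
    obtain ⟨z, hz, hzd⟩ := hbound θ hθ
    refine ⟨z, hz, ?_⟩
    have hG : G lam z - G lam θ ≤ L * dist θ z := by
      have h := (hLip lam hlam).dist_le_mul z hz.1 θ hθ
      rw [Real.coe_toNNReal _ hL.le, dist_comm z θ] at h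
      exact (le_abs_self _).trans h
    have hpen : 2 * L * dist θ z ≤ (1 / ε) * phi θ := by
      rw [le_div_iff₀ (by positivity)] at hεle
      rw [one_div, inv_mul_eq_div, le_div_iff₀ hε]
      calc 2 * L * dist θ z * ε = ε * (2 * L) * dist θ z := by ring
        _ ≤ c * dist θ z := by gcongr
        _ ≤ phi θ := hzd
    linarith
  ext ⟨lam, θ⟩
  constructor
  · rintro ⟨⟨hlam, hθ⟩, hmin⟩
    refine ⟨⟨hlam, hθ.1⟩, fun y hy => ?_⟩
    obtain ⟨z, hz, hzy⟩ := hproj y.1 hy.1 y.2 hy.2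
    have h := hmin (y.1, z) ⟨hy.1, hz⟩
    have hd : 0 ≤ L * dist y.2 z := by positivity
    rw [hzero _ hθ]
    dsimp only at h ⊢
    linarith
  · rintro ⟨⟨hlam, hθ⟩, hmin⟩
    obtain ⟨z, hz, hzθ⟩ := hproj lam hlam θ hθ
    have h := hmin (lam, z) ⟨hlam, hz.1⟩
    rw [hzero z hz] at h
    dsimp only at h
    have hd : dist θ z = 0 :=
      le_antisymm (le_of_mul_le_mul_left (by linarith) hL) dist_nonneg
    obtain rfl := dist_eq_zero.1 hd
    refine ⟨⟨hlam, hz⟩, fun y hy => ?_⟩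
    simpa [hzero _ hz, hzero _ hy.2] using hmin y ⟨hy.1, hy.2.1⟩
end

section
/- Let p ≥ 1, σ ∈ (0, 1/2], and let θ, θ′ ∈ [0,1]^p be such that for every index i with θ_i ≠ θ′_i one has (θ_i − 1/2)(θ′_i − 1/2) ≥ 0, |θ′_i − 1/2| ≤ |θ_i − 1/2|, and 2σ ≤ |θ_i − 1/2|. Then for every such index i it holds that |(θ_i + θ′_i)/2 − 1/2| = (|θ_i − 1/2| + |θ′_i − 1/2|)/2 ≥ σ, and consequently φ(θ′) − φ(θ) ≥ 2σ·‖θ′ − θ‖, where φ(θ) = Σ_{i=1}^p θ_i(1−θ_i) and ‖·‖ is the Euclidean norm. -/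
open scoped BigOperators

/-- Numbers of the same sign satisfy `|a + b| = |a| + |b|`. -/
theorem abs_add_eq_of_mul_nonneg {a b : ℝ} (hab : 0 ≤ a * b) : |a + b| = |a| + |b| :=
  (abs_add_eq_add_abs_iff a b).mpr (mul_nonneg_iff.mp hab)

/-- If `b` has the sign of `a` and is no larger in absolute value, then `a ^ 2 - b ^ 2` controls
`|b - a|` by any lower bound of `|a|`. -/
theorem mul_abs_sub_le_sq_sub_sq {a b c : ℝ} (hab : 0 ≤ a * b) (hba : |b| ≤ |a|)
    (hc : c ≤ |a|) : c * |b - a| ≤ a ^ 2 - b ^ 2 := by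
  have hsub : |b - a| = |a| - |b| := by
    rcases mul_nonneg_iff.mp hab with ⟨ha, hb⟩ | ⟨ha, hb⟩
    · rw [abs_of_nonneg ha, abs_of_nonneg hb] at *
      rw [abs_of_nonpos (by linarith)]
      ring
    · rw [abs_of_nonpos ha, abs_of_nonpos hb] at *
      rw [abs_of_nonneg (by linarith)]
      ring
  rw [hsub, ← sq_abs a, ← sq_abs b]
  nlinarith [mul_le_mul_of_nonneg_right hc (sub_nonneg.mpr hba),
    mul_nonneg (abs_nonneg b) (sub_nonneg.mpr hba)]

/-- Remark after Lemma 2: under the sign and distance conditions on each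
coordinate where `θ` and `θ'` differ, the midpoint identity
`|(θ_i + θ'_i)/2 - 1/2| = (|θ_i - 1/2| + |θ'_i - 1/2|)/2 ≥ σ` holds, and consequently
`φ(θ') - φ(θ) ≥ 2σ ‖θ' - θ‖`. -/
theorem phi_monotone_lower_bound_of_sign {p : ℕ} (hp : 1 ≤ p)
    (σ : ℝ) (hσ : σ ∈ Set.Ioc (0 : ℝ) (1 / 2))
    (θ θ' : EuclideanSpace ℝ (Fin p))
    (hθ : ∀ i, θ i ∈ Set.Icc (0 : ℝ) 1) (hθ' : ∀ i, θ' i ∈ Set.Icc (0 : ℝ) 1)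
    (h : ∀ i, θ i ≠ θ' i →
      0 ≤ (θ i - 1 / 2) * (θ' i - 1 / 2) ∧ |θ' i - 1 / 2| ≤ |θ i - 1 / 2| ∧
        2 * σ ≤ |θ i - 1 / 2|) :
    (∀ i, θ i ≠ θ' i →
      |(θ i + θ' i) / 2 - 1 / 2| = (|θ i - 1 / 2| + |θ' i - 1 / 2|) / 2 ∧
      σ ≤ |(θ i + θ' i) / 2 - 1 / 2|) ∧
    2 * σ * ‖θ' - θ‖ ≤ phi θ' - phi θ := by
  constructor
  · intro i hi
    obtain ⟨hs, -, hd⟩ := h i hi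
    have hmid : |(θ i + θ' i) / 2 - 1 / 2| = (|θ i - 1 / 2| + |θ' i - 1 / 2|) / 2 := by
      rw [← abs_add_eq_of_mul_nonneg hs,
        show (θ i + θ' i) / 2 - 1 / 2 = ((θ i - 1 / 2) + (θ' i - 1 / 2)) / 2 by ring,
        abs_div, abs_two]
    refine ⟨hmid, ?_⟩
    rw [hmid]
    linarith [abs_nonneg (θ' i - 1 / 2)]
  · calc 2 * σ * ‖θ' - θ‖ ≤ 2 * σ * ∑ i, |(θ' - θ) i| :=
          mul_le_mul_of_nonneg_left (EuclideanSpace.norm_le_sum_abs _) (by linarith [hσ.1])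
      _ = ∑ i, 2 * σ * |θ' i - θ i| := by simp only [Finset.mul_sum, PiLp.sub_apply]
      _ ≤ ∑ i, (θ' i * (1 - θ' i) - θ i * (1 - θ i)) := by
          refine Finset.sum_le_sum fun i _ => ?_
          by_cases hi : θ i = θ' i
          · simp [hi]
          · obtain ⟨hs, hle, hd⟩ := h i hi
            have key := mul_abs_sub_le_sq_sub_sq hs hle hd
            rw [sub_sub_sub_cancel_right] at key
            linarith
      _ = phi θ' - phi θ := by simp only [phi, Finset.sum_sub_distrib]
end

section
/- Let p ≥ 1, σ ∈ (0, 1/2], and let θ ∈ {0,1}^p. Then for every θ′ ∈ [0,1]^p with ‖θ′ − θ‖ ≤ 1 − 2σ (Euclidean norm), it holds that φ(θ′) ≥ 2σ·‖θ′ − θ‖, where φ(θ) = Σ_{i=1}^p θ_i(1−θ_i). -/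
open scoped BigOperators

/-- On the unit cube, `phi` is the gap between the `ℓ¹` distance and the squared Euclidean
distance to any binary point. -/
theorem phi_eq_sum_abs_sub_norm_sq {p : ℕ} {θ θ' : EuclideanSpace ℝ (Fin p)}
    (hθ : ∀ i, θ i = 0 ∨ θ i = 1) (hθ' : ∀ i, θ' i ∈ Set.Icc (0 : ℝ) 1) :
    phi θ' = ∑ i, |(θ' - θ) i| - ‖θ' - θ‖ ^ 2 := by
  rw [EuclideanSpace.real_norm_sq_eq, ← Finset.sum_sub_distrib, phi]
  refine Finset.sum_congr rfl fun i _ => ?_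
  obtain ⟨h0, h1⟩ := hθ' i
  rcases hθ i with h | h
  · rw [PiLp.sub_apply, h, sub_zero, abs_of_nonneg h0]
    ring
  · rw [PiLp.sub_apply, h, abs_of_nonpos (sub_nonpos.mpr h1)]
    ring

/-- Corollary 2: for a binary point `θ` and any `θ' ∈ [0,1]^p` with
`‖θ' - θ‖ ≤ 1 - 2σ` (Euclidean norm), it holds `φ(θ') ≥ 2σ ‖θ' - θ‖`. -/
theorem phi_lower_bound_near_binary {p : ℕ} (hp : 1 ≤ p)
    (σ : ℝ) (hσ : σ ∈ Set.Ioc (0 : ℝ) (1 / 2))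
    (θ : EuclideanSpace ℝ (Fin p)) (hθ : ∀ i, θ i = 0 ∨ θ i = 1) :
    ∀ θ' : EuclideanSpace ℝ (Fin p), (∀ i, θ' i ∈ Set.Icc (0 : ℝ) 1) →
      ‖θ' - θ‖ ≤ 1 - 2 * σ → 2 * σ * ‖θ' - θ‖ ≤ phi θ' := by
  intro θ' hθ' hr
  rw [phi_eq_sum_abs_sub_norm_sq hθ hθ']
  nlinarith [EuclideanSpace.norm_le_sum_abs (θ' - θ), norm_nonneg (θ' - θ)]
end

section
/- Let p ≥ 1, σ ∈ (0, 1/2], and let θ ∈ {0,1}^p. Then for every θ′ ∈ [0,1]^p with ‖θ′ − θ‖_∞ ≤ 1 − 2σ, where ‖x‖_∞ = max_{1≤i≤p} |x_i|, it holds that φ(θ′) ≥ 2σ·‖θ′ − θ‖, where ‖·‖ is the Euclidean norm and φ(θ) = Σ_{i=1}^p θ_i(1−θ_i). -/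
open scoped BigOperators

/-- Remark after Corollary 2: for a binary point `θ` and any `θ' ∈ [0,1]^p` with
`‖θ' - θ‖_∞ ≤ 1 - 2σ` (supremum norm), it holds `φ(θ') ≥ 2σ ‖θ' - θ‖`
(Euclidean norm). -/
theorem phi_lower_bound_near_binary_sup {p : ℕ} (hp : 1 ≤ p)
    (σ : ℝ) (hσ : σ ∈ Set.Ioc (0 : ℝ) (1 / 2))
    (θ : EuclideanSpace ℝ (Fin p)) (hθ : ∀ i, θ i = 0 ∨ θ i = 1) :
    ∀ θ' : EuclideanSpace ℝ (Fin p), (∀ i, θ' i ∈ Set.Icc (0 : ℝ) 1) →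
      (⨆ i, |θ' i - θ i|) ≤ 1 - 2 * σ → 2 * σ * ‖θ' - θ‖ ≤ phi θ' := by
  intro θ' hθ' hsup
  have hcoord : ∀ i, |θ' i - θ i| ≤ 1 - 2 * σ := fun i =>
    (le_ciSup (f := fun i => |θ' i - θ i|) (Set.finite_range _).bddAbove i).trans hsup
  have hterm : ∀ i, 2 * σ * |(θ' - θ) i| ≤ θ' i * (1 - θ' i) := by
    intro i
    obtain ⟨h0, h1⟩ := hθ' i
    have hi := hcoord i
    rw [PiLp.sub_apply]
    rcases hθ i with h | h
    · rw [h, sub_zero, abs_of_nonneg h0] at hi ⊢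
      nlinarith
    · rw [h, abs_of_nonpos (by linarith)] at hi ⊢
      nlinarith
  calc
    2 * σ * ‖θ' - θ‖ ≤ 2 * σ * ∑ i, |(θ' - θ) i| :=
      mul_le_mul_of_nonneg_left (EuclideanSpace.norm_le_sum_abs _) (by linarith [hσ.1])
    _ = ∑ i, 2 * σ * |(θ' - θ) i| := Finset.mul_sum ..
    _ ≤ phi θ' := Finset.sum_le_sum fun i _ => hterm i
end

section
/- Let p ≥ 1, let θ ∈ {0,1}^p, θ̄ ∈ [0,1]^p, and c ∈ ℝ satisfy ‖θ − θ̄‖_∞ < c < 1/2. For t ∈ [0,1] set θ^t := (1−t)·θ̄ + t·θ. Then for every t ∈ [0,1], φ(θ̄) − φ(θ^t) ≥ (1 − 2c)·‖θ^t − θ̄‖, where ‖·‖ is the Euclidean norm and φ(θ) = Σ_{i=1}^p θ_i(1−θ_i). -/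
open scoped BigOperators

/-- The one-dimensional estimate for the penalty `u (1 - u)` along the segment from `b` to a
binary point `a`. -/
theorem mul_abs_segment_sub_le {a b c t : ℝ} (ha : a = 0 ∨ a = 1) (hb : b ∈ Set.Icc (0 : ℝ) 1)
    (hab : |a - b| ≤ c) (ht : t ∈ Set.Icc (0 : ℝ) 1) :
    (1 - 2 * c) * |((1 - t) * b + t * a) - b| ≤
      b * (1 - b) - ((1 - t) * b + t * a) * (1 - ((1 - t) * b + t * a)) := by
  obtain ⟨hb0, hb1⟩ := hb
  obtain ⟨ht0, ht1⟩ := ht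
  have hseg : ((1 - t) * b + t * a) - b = t * (a - b) := by ring
  rw [hseg, abs_mul, abs_of_nonneg ht0]
  have key : b * (1 - b) - ((1 - t) * b + t * a) * (1 - ((1 - t) * b + t * a)) =
      t * |a - b| * (1 - (2 - t) * |a - b|) := by
    rcases ha with rfl | rfl
    · rw [zero_sub, abs_neg, abs_of_nonneg hb0]; ring
    · rw [abs_of_nonneg (sub_nonneg.mpr hb1)]; ring
  rw [key, mul_comm]
  refine mul_le_mul_of_nonneg_left ?_ (mul_nonneg ht0 (abs_nonneg _))
  nlinarith [mul_nonneg ht0 (abs_nonneg (a - b))]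

/-- Lemma (key estimate): for a binary point `θ`, a point `θ̄ ∈ [0,1]^p` with
`‖θ - θ̄‖_∞ < c < 1/2`, and `θ^t = (1-t) θ̄ + t θ`, it holds
`φ(θ̄) - φ(θ^t) ≥ (1 - 2c) ‖θ^t - θ̄‖`. -/
theorem phi_segment_decrease {p : ℕ} (hp : 1 ≤ p)
    (θ θBar : EuclideanSpace ℝ (Fin p)) (c : ℝ)
    (hθ : ∀ i, θ i = 0 ∨ θ i = 1) (hθBar : ∀ i, θBar i ∈ Set.Icc (0 : ℝ) 1)
    (hdist : (⨆ i, |θ i - θBar i|) < c) (hc : c < 1 / 2)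
    (t : ℝ) (ht : t ∈ Set.Icc (0 : ℝ) 1) :
    (1 - 2 * c) * ‖((1 - t) • θBar + t • θ) - θBar‖ ≤
      phi θBar - phi ((1 - t) • θBar + t • θ) := by
  have hcoord : ∀ i, |θ i - θBar i| ≤ c := fun i =>
    (le_ciSup (Set.finite_range fun i => |θ i - θBar i|).bddAbove i).trans hdist.le
  calc (1 - 2 * c) * ‖((1 - t) • θBar + t • θ) - θBar‖
      ≤ (1 - 2 * c) * ∑ i, |(((1 - t) • θBar + t • θ) - θBar) i| :=
        mul_le_mul_of_nonneg_left (EuclideanSpace.norm_le_sum_abs _) (by linarith)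
    _ ≤ phi θBar - phi ((1 - t) • θBar + t • θ) := by
        rw [phi, phi, ← Finset.sum_sub_distrib, Finset.mul_sum]
        exact Finset.sum_le_sum fun i _ =>
          mul_abs_segment_sub_le (hθ i) (hθBar i) (hcoord i) ht
end
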